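/- For a unit vector n⃗ ∈ ℝ³, let |n⃗⟩ be the unit eigenvector of n⃗·σ⃗ with eigenvalue +1. Define for each unit vector m⃗ ∈ S² the value V(m⃗) = sign((m⃗+n⃗)·a⃗)·‖a⃗‖ + a₀ (taking +‖a⃗‖ when (m⃗+n⃗)·a⃗ ≥ 0, else -‖a⃗‖). Then the average of V(m⃗) over the uniform probability measure on S² equals ⟨n⃗|(a₀I + a⃗·σ⃗)|n⃗⟩, for every a₀ ∈ ℝ and a⃗ ∈ ℝ³. -/

import Mathlib

open MeasureTheory Matrix

noncomputable def σx : Matrix (Fin 2) (Fin 2) ℂ := !![0, 1; 1, 0]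
noncomputable def σy : Matrix (Fin 2) (Fin 2) ℂ := !![0, -Complex.I; Complex.I, 0]
noncomputable def σz : Matrix (Fin 2) (Fin 2) ℂ := !![1, 0; 0, -1]

/-- The Pauli vector `a⃗ · σ⃗`. -/
noncomputable def pauliVec (a : Fin 3 → ℝ) : Matrix (Fin 2) (Fin 2) ℂ :=
  a 0 • σx + a 1 • σy + a 2 • σz

/-- The uniform probability measure on the unit sphere `S² ⊆ ℝ³`. -/
noncomputable def uniformSphereMeasure :
    Measure (Metric.sphere (0 : EuclideanSpace ℝ (Fin 3)) 1) :=
  ((volume : Measure (EuclideanSpace ℝ (Fin 3))).toSphere Set.univ)⁻¹ •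
    (volume : Measure (EuclideanSpace ℝ (Fin 3))).toSphere

/-- Bell's hidden-variable value assignment: in the state `|n⃗⟩` with hidden variable
`m⃗ ∈ S²`, the observable `a₀ I + a⃗·σ⃗` receives the value
`a₀ ± ‖a⃗‖` according to the sign of `(m⃗ + n⃗)·a⃗`. -/
noncomputable def bellValue (a₀ : ℝ) (a nvec : Fin 3 → ℝ)
    (m : Metric.sphere (0 : EuclideanSpace ℝ (Fin 3)) 1) : ℝ :=
  if 0 ≤ ∑ i, ((m : EuclideanSpace ℝ (Fin 3)) i + nvec i) * a i then
    a₀ + Real.sqrt (∑ i, a i ^ 2)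
  else
    a₀ - Real.sqrt (∑ i, a i ^ 2)

lemma volume_norm_sq_lt (c : ℝ) :
    volume {w : EuclideanSpace ℝ (Fin 2) | ‖w‖ ^ 2 < c} = ENNReal.ofReal (Real.pi * c) := by
  have hball : {w : EuclideanSpace ℝ (Fin 2) | ‖w‖ ^ 2 < c} = Metric.ball 0 (Real.sqrt c) := by
    ext w
    simp [Real.lt_sqrt (norm_nonneg w)]
  rw [hball, EuclideanSpace.volume_ball_fin_two, ← ENNReal.ofReal_pow (Real.sqrt_nonneg c),
    ← ENNReal.ofReal_mul (by positivity)]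
  rcases le_total 0 c with hc | hc
  · rw [Real.sq_sqrt hc, mul_comm]
  · rw [Real.sqrt_eq_zero_of_nonpos hc,
      ENNReal.ofReal_of_nonpos (mul_nonpos_of_nonneg_of_nonpos Real.pi_pos.le hc)]
    simp

/-- The area of the slice at height `x` of the open spherical sector with axis the first
coordinate axis and opening angle `arccos t`. -/
lemma volume_sector_slice {t : ℝ} (ht₀ : 0 ≤ t) (x : ℝ) :
    volume {w : EuclideanSpace ℝ (Fin 2) |
        x ^ 2 + ‖w‖ ^ 2 < 1 ∧ t * Real.sqrt (x ^ 2 + ‖w‖ ^ 2) < x} =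
      (Set.Ioc 0 t).indicator
          (fun x ↦ ENNReal.ofReal (Real.pi * (x ^ 2 * ((t ^ 2)⁻¹ - 1)))) x +
        (Set.Ioo t 1).indicator (fun x ↦ ENNReal.ofReal (Real.pi * (1 - x ^ 2))) x := by
  have hcone (hx : 0 < x) (w : EuclideanSpace ℝ (Fin 2)) :
      t * Real.sqrt (x ^ 2 + ‖w‖ ^ 2) < x ↔ t ^ 2 * (x ^ 2 + ‖w‖ ^ 2) < x ^ 2 := by
    rw [← sq_lt_sq₀ (by positivity) hx.le, mul_pow, Real.sq_sqrt (by positivity)]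
  rcases le_or_gt x 0 with hx | hx
  · have hempty : {w : EuclideanSpace ℝ (Fin 2) |
        x ^ 2 + ‖w‖ ^ 2 < 1 ∧ t * Real.sqrt (x ^ 2 + ‖w‖ ^ 2) < x} = ∅ := by
      ext w
      have : 0 ≤ t * Real.sqrt (x ^ 2 + ‖w‖ ^ 2) := by positivity
      simp only [Set.mem_ofPred_eq, Set.mem_empty_iff_false, iff_false, not_and, not_lt]
      intro
      linarith
    rw [hempty, Set.indicator_of_notMem (fun h ↦ hx.not_gt h.1),
      Set.indicator_of_notMem (fun h ↦ by linarith [h.1])]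
    simp
  rcases le_or_gt x t with hxt | hxt
  · have ht : 0 < t := hx.trans_le hxt
    rw [Set.indicator_of_mem (Set.mem_Ioc.2 ⟨hx, hxt⟩),
      Set.indicator_of_notMem (fun h ↦ hxt.not_gt h.1), add_zero, ← volume_norm_sq_lt]
    congr 1 with w
    simp only [Set.mem_ofPred_eq, hcone hx]
    have hiff : t ^ 2 * (x ^ 2 + ‖w‖ ^ 2) < x ^ 2 ↔ ‖w‖ ^ 2 < x ^ 2 * ((t ^ 2)⁻¹ - 1) := by
      rw [← lt_div_iff₀' (by positivity), div_eq_mul_inv, mul_sub, mul_one, lt_sub_iff_add_lt']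
    rw [hiff, and_iff_right_iff_imp, ← hiff]
    intro h
    have : x ^ 2 ≤ t ^ 2 := by gcongr
    nlinarith [sq_pos_of_pos ht]
  · rw [Set.indicator_of_notMem (fun h ↦ hxt.not_ge h.2), zero_add]
    have hslice : {w : EuclideanSpace ℝ (Fin 2) |
        x ^ 2 + ‖w‖ ^ 2 < 1 ∧ t * Real.sqrt (x ^ 2 + ‖w‖ ^ 2) < x} =
        {w | ‖w‖ ^ 2 < 1 - x ^ 2} := by
      ext w
      simp only [Set.mem_ofPred_eq, hcone hx]
      have : t ^ 2 < x ^ 2 := by gcongr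
      constructor
      · intro h
        linarith [h.1]
      · intro h
        exact ⟨by linarith, by nlinarith [sq_nonneg t]⟩
    rw [hslice, volume_norm_sq_lt]
    rcases lt_or_ge x 1 with hx₁ | hx₁
    · rw [Set.indicator_of_mem (Set.mem_Ioo.2 ⟨hxt, hx₁⟩)]
    · rw [Set.indicator_of_notMem (fun h ↦ hx₁.not_gt h.2)]
      have : 1 ≤ x ^ 2 := one_le_pow₀ hx₁
      exact ENNReal.ofReal_of_nonpos
        (mul_nonpos_of_nonneg_of_nonpos Real.pi_pos.le (by linarith))

lemma lintegral_sector_slice {t : ℝ} (ht₀ : 0 ≤ t) (ht₁ : t ≤ 1) :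
    ∫⁻ x, ((Set.Ioc 0 t).indicator
          (fun x ↦ ENNReal.ofReal (Real.pi * (x ^ 2 * ((t ^ 2)⁻¹ - 1)))) x +
        (Set.Ioo t 1).indicator (fun x ↦ ENNReal.ofReal (Real.pi * (1 - x ^ 2))) x) =
      ENNReal.ofReal (2 * Real.pi / 3 * (1 - t)) := by
  have hinv : 0 ≤ (1 - t ^ 2) * t := by
    have : t ^ 2 ≤ 1 := pow_le_one₀ ht₀ ht₁
    exact mul_nonneg (by linarith) ht₀
  have hcone : ∫⁻ x in Set.Ioc 0 t, ENNReal.ofReal (Real.pi * (x ^ 2 * ((t ^ 2)⁻¹ - 1))) =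
      ENNReal.ofReal (Real.pi * ((1 - t ^ 2) * t) / 3) := by
    rw [← ofReal_integral_eq_lintegral_ofReal, ← intervalIntegral.integral_of_le ht₀]
    · congr 1
      rcases ht₀.eq_or_lt with rfl | ht
      · simp
      · simp only [intervalIntegral.integral_const_mul, intervalIntegral.integral_mul_const,
          integral_pow]
        field_simp
        norm_num
        ring
    · exact (Continuous.integrableOn_Icc (by fun_prop)).mono_set Set.Ioc_subset_Icc_self
    · filter_upwards [ae_restrict_mem measurableSet_Ioc] with x hx
      have ht : 0 < t := hx.1.trans_le hx.2
      have : 1 ≤ (t ^ 2)⁻¹ := (one_le_inv₀ (by positivity)).2 (pow_le_one₀ ht₀ ht₁)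
      exact mul_nonneg Real.pi_pos.le (mul_nonneg (sq_nonneg x) (by linarith))
  have hcap : ∫⁻ x in Set.Ioo t 1, ENNReal.ofReal (Real.pi * (1 - x ^ 2)) =
      ENNReal.ofReal (Real.pi * ((1 - t) - (1 - t ^ 3) / 3)) := by
    rw [← ofReal_integral_eq_lintegral_ofReal, ← integral_Ioc_eq_integral_Ioo,
      ← intervalIntegral.integral_of_le ht₁]
    · congr 1
      rw [intervalIntegral.integral_const_mul, intervalIntegral.integral_sub (by simp)
        (Continuous.intervalIntegrable (by fun_prop) _ _), integral_pow]
      norm_num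
    · exact (Continuous.integrableOn_Icc (by fun_prop)).mono_set Set.Ioo_subset_Icc_self
    · filter_upwards [ae_restrict_mem measurableSet_Ioo] with x hx
      have : x ^ 2 ≤ 1 := pow_le_one₀ (ht₀.trans hx.1.le) hx.2.le
      exact mul_nonneg Real.pi_pos.le (by linarith)
  rw [lintegral_add_left (Measurable.indicator (by fun_prop) measurableSet_Ioc),
    lintegral_indicator measurableSet_Ioc, lintegral_indicator measurableSet_Ioo, hcone, hcap,
    ← ENNReal.ofReal_add (by positivity)]
  · congr 1
    ring
  · have : t ^ 2 ≤ 1 := pow_le_one₀ ht₀ ht₁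
    exact mul_nonneg Real.pi_pos.le (by nlinarith [mul_nonneg (sub_nonneg.2 ht₁) (sub_nonneg.2 ht₁)])

lemma volume_sector_coord {t : ℝ} (ht₀ : 0 ≤ t) (ht₁ : t ≤ 1) :
    volume {x : EuclideanSpace ℝ (Fin 3) | ‖x‖ < 1 ∧ t * ‖x‖ < x 0} =
      ENNReal.ofReal (2 * Real.pi / 3 * (1 - t)) := by
  have hf := ((MeasurePreserving.id (volume : Measure ℝ)).prod
    (PiLp.volume_preserving_toLp (Fin 2))).comp
      ((volume_preserving_piFinSuccAbove (fun _ : Fin 3 ↦ ℝ) 0).comp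
        (PiLp.volume_preserving_ofLp (Fin 3)))
  have hD : MeasurableSet {p : ℝ × EuclideanSpace ℝ (Fin 2) |
      p.1 ^ 2 + ‖p.2‖ ^ 2 < 1 ∧ t * Real.sqrt (p.1 ^ 2 + ‖p.2‖ ^ 2) < p.1} := by
    rw [Set.ofPred_and]
    exact (measurableSet_lt (by fun_prop) (by fun_prop)).inter
      (measurableSet_lt (by fun_prop) (by fun_prop))
  have hpre := hf.measure_preimage hD.nullMeasurableSet
  rw [Measure.prod_apply hD] at hpre
  simp only [Set.preimage_ofPred_eq, volume_sector_slice ht₀,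
    lintegral_sector_slice ht₀ ht₁] at hpre
  rw [← hpre]
  congr 1 with x
  have hnorm : ‖x‖ = Real.sqrt (x 0 ^ 2 + (x 1 ^ 2 + x 2 ^ 2)) := by
    simp [EuclideanSpace.norm_eq, Fin.sum_univ_three, add_assoc]
  have hlt : ‖x‖ < 1 ↔ x 0 ^ 2 + (x 1 ^ 2 + x 2 ^ 2) < 1 := by
    rw [hnorm, Real.sqrt_lt' one_pos, one_pow]
  simp only [Set.mem_ofPred_eq, hlt]
  rw [hnorm]
  simp [EuclideanSpace.norm_sq_eq, Fin.tail, Fin.sum_univ_two, MeasurableEquiv.piFinSuccAbove]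

lemma volume_sector {u : EuclideanSpace ℝ (Fin 3)} (hu : ‖u‖ = 1) {t : ℝ} (ht₀ : 0 ≤ t)
    (ht₁ : t ≤ 1) :
    volume {x : EuclideanSpace ℝ (Fin 3) | ‖x‖ < 1 ∧ t * ‖x‖ < inner ℝ u x} =
      ENNReal.ofReal (2 * Real.pi / 3 * (1 - t)) := by
  obtain ⟨b, hb⟩ := Orthonormal.exists_orthonormalBasis_extension_of_card_eq (𝕜 := ℝ)
    (E := EuclideanSpace ℝ (Fin 3)) (ι := Fin 3) (by simp) (v := fun _ ↦ u) (s := {0})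
    ⟨fun _ ↦ hu, fun i j hij ↦ (hij (Subsingleton.elim i j)).elim⟩
  have hb₀ : b 0 = u := hb 0 rfl
  have hmeas : MeasurableSet {x : EuclideanSpace ℝ (Fin 3) | ‖x‖ < 1 ∧ t * ‖x‖ < x 0} := by
    rw [Set.ofPred_and]
    exact (measurableSet_lt (by fun_prop) (by fun_prop)).inter
      (measurableSet_lt (by fun_prop) (by fun_prop))
  rw [← volume_sector_coord ht₀ ht₁,
    ← b.measurePreserving_repr.measure_preimage hmeas.nullMeasurableSet]
  simp [b.repr_apply_apply, hb₀]

instance : IsProbabilityMeasure uniformSphereMeasure where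
  measure_univ := by
    rw [uniformSphereMeasure, Measure.smul_apply, smul_eq_mul]
    exact ENNReal.inv_mul_cancel (by simp [Real.pi_pos]) (measure_ne_top _ _)

open scoped Pointwise in
/-- Archimedes' hat-box theorem for an open cap contained in a hemisphere. -/
lemma uniformSphereMeasure_real_openCap {u : EuclideanSpace ℝ (Fin 3)} (hu : ‖u‖ = 1) {t : ℝ}
    (ht₀ : 0 ≤ t) (ht₁ : t ≤ 1) :
    uniformSphereMeasure.real {m | t < inner ℝ u (m : EuclideanSpace ℝ (Fin 3))} =
      (1 - t) / 2 := by
  have hmeas : MeasurableSet {m : Metric.sphere (0 : EuclideanSpace ℝ (Fin 3)) 1 |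
      t < inner ℝ u (m : EuclideanSpace ℝ (Fin 3))} :=
    measurableSet_lt (by fun_prop) (by fun_prop)
  have hcone : Set.Ioo (0 : ℝ) 1 • (Subtype.val '' {m : Metric.sphere (0 : EuclideanSpace ℝ (Fin 3)) 1 |
      t < inner ℝ u (m : EuclideanSpace ℝ (Fin 3))}) =
      {x : EuclideanSpace ℝ (Fin 3) | ‖x‖ < 1 ∧ t * ‖x‖ < inner ℝ u x} := by
    ext x
    simp only [Set.mem_smul, Set.mem_image, Set.mem_ofPred_eq]
    constructor
    · rintro ⟨r, ⟨hr₀, hr₁⟩, _, ⟨m, hm, rfl⟩, rfl⟩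
      have hnorm : ‖(m : EuclideanSpace ℝ (Fin 3))‖ = 1 := by simp
      rw [norm_smul, hnorm, Real.norm_of_nonneg hr₀.le, inner_smul_right, mul_one, mul_comm]
      exact ⟨hr₁, by gcongr⟩
    · rintro ⟨hx₁, hx⟩
      have hx₀ : 0 < ‖x‖ := by
        rw [norm_pos_iff]
        rintro rfl
        simp at hx
      refine ⟨‖x‖, ⟨hx₀, hx₁⟩, ‖x‖⁻¹ • x, ⟨⟨‖x‖⁻¹ • x, ?_⟩, ?_, rfl⟩, ?_⟩
      · simp [norm_smul, hx₀.ne']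
      · rw [inner_smul_right, ← div_eq_inv_mul, lt_div_iff₀ hx₀]
        exact hx
      · rw [smul_inv_smul₀ hx₀.ne']
  have hnonneg : 0 ≤ 2 * Real.pi / 3 * (1 - t) :=
    mul_nonneg (by positivity) (by linarith)
  rw [measureReal_def, uniformSphereMeasure, Measure.smul_apply, Measure.toSphere_apply' _ hmeas,
    hcone, volume_sector hu ht₀ ht₁, Measure.toSphere_apply_univ,
    EuclideanSpace.volume_ball_fin_three]
  simp only [finrank_euclideanSpace, Fintype.card_fin, smul_eq_mul, ENNReal.toReal_mul,
    ENNReal.toReal_inv, ENNReal.toReal_ofReal hnonneg, ENNReal.toReal_natCast,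
    ENNReal.ofReal_one, one_pow, ENNReal.toReal_one,
    ENNReal.toReal_ofReal (show 0 ≤ Real.pi * 4 / 3 by positivity)]
  field_simp
  norm_num

/-- Archimedes' hat-box theorem for closed caps. -/
lemma uniformSphereMeasure_real_closedCap {u : EuclideanSpace ℝ (Fin 3)} (hu : ‖u‖ = 1) {t : ℝ}
    (ht : |t| ≤ 1) :
    uniformSphereMeasure.real {m | t ≤ inner ℝ u (m : EuclideanSpace ℝ (Fin 3))} =
      (1 - t) / 2 := by
  obtain ⟨ht₁', ht₁⟩ := abs_le.1 ht
  rcases le_or_gt t 0 with ht₀ | ht₀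
  · have hcompl : {m : Metric.sphere (0 : EuclideanSpace ℝ (Fin 3)) 1 |
        t ≤ inner ℝ u (m : EuclideanSpace ℝ (Fin 3))} =
        {m : Metric.sphere (0 : EuclideanSpace ℝ (Fin 3)) 1 |
          -t < inner ℝ (-u) (m : EuclideanSpace ℝ (Fin 3))}ᶜ := by
      ext m
      simp [inner_neg_left]
    rw [hcompl, probReal_compl_eq_one_sub (measurableSet_lt (by fun_prop) (by fun_prop)),
      uniformSphereMeasure_real_openCap (by rwa [norm_neg]) (by linarith) (by linarith)]
    ring
  · apply le_antisymm
    · refine le_of_forall_pos_le_add fun ε hε ↦ ?_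
      have hs : max 0 (t - ε) < t := max_lt ht₀ (by linarith)
      calc
        _ ≤ uniformSphereMeasure.real
            {m | max 0 (t - ε) < inner ℝ u (m : EuclideanSpace ℝ (Fin 3))} :=
          measureReal_mono fun m hm ↦ hs.trans_le hm
        _ = (1 - max 0 (t - ε)) / 2 :=
          uniformSphereMeasure_real_openCap hu (le_max_left _ _) (by linarith)
        _ ≤ (1 - t) / 2 + ε := by linarith [le_max_right 0 (t - ε)]
    · rw [← uniformSphereMeasure_real_openCap hu ht₀.le ht₁]
      exact measureReal_mono fun m (hm : t < _) ↦ hm.le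

lemma re_expectation_pauliVec {a nvec : Fin 3 → ℝ} {ψ : Fin 2 → ℂ}
    (hψ : star ψ ⬝ᵥ ψ = 1) (heig : (pauliVec nvec).mulVec ψ = ψ) (a₀ : ℝ) :
    (star ψ ⬝ᵥ (a₀ • (1 : Matrix (Fin 2) (Fin 2) ℂ) + pauliVec a).mulVec ψ).re =
      a₀ + ∑ i, nvec i * a i := by
  have hnorm := congrArg Complex.re hψ
  have h₀re := congrArg Complex.re (congrFun heig 0)
  have h₀im := congrArg Complex.im (congrFun heig 0)
  have h₁re := congrArg Complex.re (congrFun heig 1)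
  have h₁im := congrArg Complex.im (congrFun heig 1)
  simp [pauliVec, σx, σy, σz, Matrix.mulVec, dotProduct, Fin.sum_univ_two] at hnorm h₀re h₀im h₁re h₁im
  have hx : 2 * ((ψ 0).re * (ψ 1).re + (ψ 0).im * (ψ 1).im) = nvec 0 := by
    linear_combination nvec 0 * hnorm - (ψ 1).re * h₀re - (ψ 1).im * h₀im - (ψ 0).re * h₁re -
      (ψ 0).im * h₁im
  have hy : 2 * ((ψ 0).re * (ψ 1).im - (ψ 0).im * (ψ 1).re) = nvec 1 := by
    linear_combination nvec 1 * hnorm - (ψ 1).im * h₀re + (ψ 1).re * h₀im + (ψ 0).im * h₁re -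
      (ψ 0).re * h₁im
  have hz : (ψ 0).re ^ 2 + (ψ 0).im ^ 2 - (ψ 1).re ^ 2 - (ψ 1).im ^ 2 = nvec 2 := by
    linear_combination nvec 2 * hnorm - (ψ 0).re * h₀re - (ψ 0).im * h₀im + (ψ 1).re * h₁re +
      (ψ 1).im * h₁im
  simp [pauliVec, σx, σy, σz, Matrix.mulVec, dotProduct, Fin.sum_univ_two, Fin.sum_univ_three]
  linear_combination a₀ * hnorm + a 0 * hx + a 1 * hy + a 2 * hz

lemma integral_bellValue (a₀ : ℝ) {a nvec : Fin 3 → ℝ} (hn : ∑ i, nvec i ^ 2 = 1) :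
    ∫ m, bellValue a₀ a nvec m ∂uniformSphereMeasure = a₀ + ∑ i, nvec i * a i := by
  rcases eq_or_ne a 0 with rfl | ha
  · simp [bellValue]
  set v : EuclideanSpace ℝ (Fin 3) := WithLp.toLp 2 a with hv
  have hv₀ : 0 < ‖v‖ := by simpa [hv] using ha
  have hsqrt : Real.sqrt (∑ i, a i ^ 2) = ‖v‖ := by simp [hv, EuclideanSpace.norm_eq]
  set n : EuclideanSpace ℝ (Fin 3) := WithLp.toLp 2 nvec with hn'
  have hnorm : ‖n‖ = 1 := by simp [hn', EuclideanSpace.norm_eq, hn]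
  have hinner : inner ℝ v n = ∑ i, nvec i * a i := by simp [hv, hn', PiLp.inner_apply]
  have hu : ‖‖v‖⁻¹ • v‖ = 1 := by simp [norm_smul, hv₀.ne']
  have hcap := uniformSphereMeasure_real_closedCap hu (t := -inner ℝ (‖v‖⁻¹ • v) n) (by
    rw [abs_neg]
    simpa [hu, hnorm] using abs_real_inner_le_norm (‖v‖⁻¹ • v) n)
  set S : Set (Metric.sphere (0 : EuclideanSpace ℝ (Fin 3)) 1) :=
    {m | -inner ℝ (‖v‖⁻¹ • v) n ≤ inner ℝ (‖v‖⁻¹ • v) (m : EuclideanSpace ℝ (Fin 3))} with hS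
  have hSmeas : MeasurableSet S := measurableSet_le (by fun_prop) (by fun_prop)
  have hvalue (m : Metric.sphere (0 : EuclideanSpace ℝ (Fin 3)) 1) :
      bellValue a₀ a nvec m = (a₀ - ‖v‖) + S.indicator (fun _ ↦ 2 * ‖v‖) m := by
    have hsum : ∑ i, ((m : EuclideanSpace ℝ (Fin 3)) i + nvec i) * a i =
        ‖v‖ * (inner ℝ (‖v‖⁻¹ • v) (m : EuclideanSpace ℝ (Fin 3)) +
          inner ℝ (‖v‖⁻¹ • v) n) := by
      rw [← inner_add_right, real_inner_smul_left, mul_inv_cancel_left₀ hv₀.ne']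
      simp [hv, hn', PiLp.inner_apply]
    have hmem : 0 ≤ ∑ i, ((m : EuclideanSpace ℝ (Fin 3)) i + nvec i) * a i ↔ m ∈ S := by
      rw [hsum, mul_nonneg_iff_of_pos_left hv₀, hS, Set.mem_ofPred_eq, neg_le_iff_add_nonneg]
    simp only [bellValue, hmem, hsqrt, Set.indicator_apply]
    split_ifs <;> ring
  simp_rw [hvalue]
  rw [integral_add (integrable_const _) ((integrable_const _).indicator hSmeas),
    integral_indicator_const _ hSmeas, hcap, real_inner_smul_left, hinner]
  simp
  field_simp
  ring

/-- Bell's hidden-variable model for one qubit: averaging `bellValue`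
over the uniform measure on `S²` reproduces the quantum expectation
`⟨n⃗|(a₀ I + a⃗·σ⃗)|n⃗⟩` for every observable, where `|n⃗⟩` is the unit
`+1`-eigenvector of `n⃗·σ⃗`. -/
theorem bell_hidden_variable_model (a₀ : ℝ) (a nvec : Fin 3 → ℝ)
    (hn : ∑ i, nvec i ^ 2 = 1) (ψ : Fin 2 → ℂ)
    (hψ : star ψ ⬝ᵥ ψ = 1) (heig : (pauliVec nvec).mulVec ψ = ψ) :
    ∫ m, bellValue a₀ a nvec m ∂uniformSphereMeasure
      = (star ψ ⬝ᵥ (a₀ • (1 : Matrix (Fin 2) (Fin 2) ℂ) + pauliVec a).mulVec ψ).re := by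
  rw [integral_bellValue a₀ hn, re_expectation_pauliVec hψ heig a₀]
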